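/- arXiv:1506.00067 — 2 statements merged into one kernel-verified Lean document; each statement's English description precedes it below -/
import Mathlib

section
/- For every (a,b) ∈ S there exists an open set U ⊂ D₁ with (a,b) ∈ U such that X_{(a',b')} = X_{(a,b)} for every (a',b') ∈ U. -/
open Filter MeasureTheory

namespace DoublingHole

/-- One-sided binary sequences (indexed from 0, corresponding to x₁x₂x₃⋯). -/
abbrev Seq : Type := ℕ → Bool

/-- The one-sided shift map σ. -/
def shift (x : Seq) : Seq := fun n => x (n + 1)

/-- Strict lexicographic order ≺ on sequences. -/
def lexLt (x y : Seq) : Prop := ∃ k : ℕ, (∀ i, i < k → x i = y i) ∧ x k < y k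

/-- Reflexive lexicographic order ≼ on sequences. -/
def lexLe (x y : Seq) : Prop := lexLt x y ∨ x = y

/-- The lexicographic subshift Σ_{(α,β)} = {x : β ≼ σⁿx ≼ α for all n ≥ 0}. -/
def lexSubshift (α β : Seq) : Set Seq :=
  {x | ∀ n : ℕ, lexLe β (shift^[n] x) ∧ lexLe (shift^[n] x) α}

/-- The projection π : Σ₂ → [0,1], π(x) = Σ xᵢ 2^{-i}. -/
noncomputable def piMap (x : Seq) : ℝ := ∑' i : ℕ, if x i then (1 : ℝ) / 2 ^ (i + 1) else 0

/-- The mirror image x̄ of a sequence. -/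
def mirror (x : Seq) : Seq := fun n => !(x n)

/-- The set P of Parry sequences: α₁ = 1 and σⁿα ≼ α for all n ≥ 1. -/
def ParryP : Set Seq := {α | α 0 = true ∧ ∀ n, 1 ≤ n → lexLe (shift^[n] α) α}

/-- The set P̄ of mirror images of Parry sequences. -/
def barP : Set Seq := {β | mirror β ∈ ParryP}

/-- Periodic sequences. -/
def PerSet : Set Seq := {x | ∃ k, 1 ≤ k ∧ shift^[k] x = x}

/-- Membership in the lexicographic world LW. -/
def inLW (α β : Seq) : Prop :=
  α ∈ ParryP ∧ β ∈ barP ∧ ∀ n, 1 ≤ n → lexLe β (shift^[n] α) ∧ lexLe (shift^[n] β) α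

/-- The doubling map x ↦ 2x (mod 1) on S¹ identified with [0,1). -/
noncomputable def dbl (x : ℝ) : ℝ := Int.fract (2 * x)

/-- The exceptional set X_{(a,b)} of points whose orbit avoids the hole (a,b). -/
def Xset (a b : ℝ) : Set ℝ :=
  {x | x ∈ Set.Ico (0 : ℝ) 1 ∧ ∀ n : ℕ, dbl^[n] x ∉ Set.Ioo a b}

/-- The attractor Λ_{(a,b)} = [2b-1, 2a] ∩ X_{(a,b)}. -/
def Lam (a b : ℝ) : Set ℝ := Set.Icc (2 * b - 1) (2 * a) ∩ Xset a b

/-- χ(a) = sup{b : X_{(a,b)} is uncountable}. -/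
noncomputable def chiFn (a : ℝ) : ℝ :=
  sSup {b | b ∈ Set.Ico (0 : ℝ) 1 ∧ ¬ (Xset a b).Countable}

/-- The parameter region D₁. -/
def D1 : Set (ℝ × ℝ) :=
  {p | p.1 ∈ Set.Ioo (1/4 : ℝ) (1/2) ∧ p.2 ∈ Set.Ioo (1/2 : ℝ) (3/4) ∧ p.2 ≤ chiFn p.1}

/-- The set S of parameters whose endpoints both fall into the hole. -/
def Sset : Set (ℝ × ℝ) :=
  {p | p ∈ D1 ∧ (∃ n, 1 ≤ n ∧ dbl^[n] p.1 ∈ Set.Ioo p.1 p.2) ∧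
        ∃ m, 1 ≤ m ∧ dbl^[m] p.2 ∈ Set.Ioo p.1 p.2}

/-- The finite word w occurs in (is a factor of) the sequence x. -/
def occursIn (w : List Bool) (x : Seq) : Prop :=
  ∃ i : ℕ, w = List.ofFn fun j : Fin w.length => x (i + (j : ℕ))

/-- The language of a subshift: all finite factors of its elements. -/
def Lang (A : Set Seq) : Set (List Bool) := {w | ∃ x ∈ A, occursIn w x}

/-- A set of sequences is a subshift of finite type if it is defined by
finitely many forbidden words. -/
def IsSFT (A : Set Seq) : Prop :=
  ∃ F : Finset (List Bool), A = {x | ∀ w ∈ F, ¬ occursIn w x}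

/-- B_n(A): the admissible words of length n. -/
def wordsOfLen (A : Set Seq) (n : ℕ) : Set (List Bool) :=
  {w | w.length = n ∧ w ∈ Lang A}

/-- Topological transitivity of a subshift, phrased via its language. -/
def TransitiveShift (A : Set Seq) : Prop :=
  ∀ u ∈ Lang A, ∀ v ∈ Lang A, ∃ t ∈ Lang A, u ++ t ++ v ∈ Lang A

/-- Cyclic rotation of a finite word. -/
def rot (w : List Bool) (k : ℕ) : List Bool := w.drop k ++ w.take k

/-- Lexicographic (dictionary) order on finite words. -/
def listLe (u v : List Bool) : Prop := List.Lex (· < ·) u v ∨ u = v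

/-- w = 0-max_w : w starts with 0 and is the lexicographically largest
cyclic permutation of itself starting with 0. -/
def isZeroMax (w : List Bool) : Prop :=
  w.headD true = false ∧
    ∀ k, k < w.length → (rot w k).headD true = false → listLe (rot w k) w

/-- w = 1-min_w : w starts with 1 and is the lexicographically smallest
cyclic permutation of itself starting with 1. -/
def isOneMin (w : List Bool) : Prop :=
  w.headD false = true ∧
    ∀ k, k < w.length → (rot w k).headD false = true → listLe w (rot w k)

/-- v is the 0-max cyclic permutation of w. -/
def isZeroMaxOf (v w : List Bool) : Prop :=
  (∃ k, k < w.length ∧ v = rot w k) ∧ v.headD true = false ∧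
    ∀ k, k < w.length → (rot w k).headD true = false → listLe (rot w k) v

/-- u is the 1-min cyclic permutation of w. -/
def isOneMinOf (u w : List Bool) : Prop :=
  (∃ k, k < w.length ∧ u = rot w k) ∧ u.headD false = true ∧
    ∀ k, k < w.length → (rot w k).headD false = true → listLe u (rot w k)

/-- The periodic sequence w^∞. -/
def periodicSeq (w : List Bool) : Seq := fun i => w.getD (i % w.length) false

/-- The sequence w followed by x. -/
def wordThen (w : List Bool) (x : Seq) : Seq :=
  fun i => if i < w.length then w.getD i false else x (i - w.length)

/-- Prepend one symbol to a sequence (e.g. 0α, 1β). -/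
def consSeq (a : Bool) (x : Seq) : Seq := fun i => if i = 0 then a else x (i - 1)

/-- A word is balanced if any two factors of equal length have numbers of 1's
differing by at most one. -/
def balanced (w : List Bool) : Prop :=
  ∀ u v : List Bool, u <:+: w → v <:+: w → u.length = v.length →
    ((u.count true : ℤ) - (v.count true : ℤ)).natAbs ≤ 1

/-- A word is cyclically balanced if its square is balanced. -/
def cycBalanced (w : List Bool) : Prop := balanced (w ++ w)

/-- Infinite concatenation of a sequence of (nonempty) finite words. -/
noncomputable def concatSeq (b : ℕ → List Bool) : Seq := fun i =>
  (b (sInf {n : ℕ | i < ∑ k ∈ Finset.range (n + 1), (b k).length})).getD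
    (i - ∑ k ∈ Finset.range (sInf {n : ℕ | i < ∑ k ∈ Finset.range (n + 1), (b k).length}), (b k).length)
    false

/-- (α,β) is renormalisable by the finite words ω and ν:
ω = 0-max_ω, ν = 1-min_ν, (0-max_ν)^∞ ≺ ω^∞, ν^∞ ≺ (1-min_ω)^∞, ℓ(ων) ≥ 3, and
0α = ω ν^{n₁^ν} ω^{n₁^ω} ν^{n₂^ν} ⋯ and 1β = ν ω^{m₁^ω} ν^{m₁^ν} ⋯ with all
exponents in ℕ ∪ {∞}; equivalently 0α (resp. 1β) is an infinite concatenation of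
copies of ω and ν whose first two blocks are ω, ν (resp. ν, ω). -/
def RenormalisableBy (α β : Seq) (ω ν : List Bool) : Prop :=
  isZeroMax ω ∧ isOneMin ν ∧
  (∀ v, isZeroMaxOf v ν → lexLt (periodicSeq v) (periodicSeq ω)) ∧
  (∀ u, isOneMinOf u ω → lexLt (periodicSeq ν) (periodicSeq u)) ∧
  3 ≤ ω.length + ν.length ∧
  (∃ b : ℕ → List Bool, b 0 = ω ∧ b 1 = ν ∧ (∀ k, b k = ω ∨ b k = ν) ∧
    consSeq false α = concatSeq b) ∧
  (∃ c : ℕ → List Bool, c 0 = ν ∧ c 1 = ω ∧ (∀ k, c k = ω ∨ c k = ν) ∧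
    consSeq true β = concatSeq c)

/-- (α,β) is renormalisable by an infinite sequence: either 0α = ω and 1β = νω
with ω infinite and ν = 1-min_ν finite, or 0α = ων and 1β = ν with ν infinite
and ω = 0-max_ω finite. -/
def RenormInfBy (α β : Seq) : Prop :=
  (∃ ν : List Bool, isOneMin ν ∧ consSeq true β = wordThen ν (consSeq false α)) ∨
  (∃ ω : List Bool, isZeroMax ω ∧ consSeq false α = wordThen ω (consSeq true β))

/-- n_α = min{n ≥ 1 : σⁿα ≻ α}. -/
noncomputable def nAlpha (α : Seq) : ℕ := sInf {n | 1 ≤ n ∧ lexLt α (shift^[n] α)}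

/-- The periodic sequence (α₁ ⋯ α_{n-1} 0)^∞. -/
def cutZero (α : Seq) (n : ℕ) : Seq :=
  fun i => if i % n = n - 1 then false else α (i % n)

/-- The periodic sequence (β₁ ⋯ β_{n-1} 1)^∞. -/
def cutOne (β : Seq) (n : ℕ) : Seq :=
  fun i => if i % n = n - 1 then true else β (i % n)

open Classical in
/-- The map ς : Σ₂¹ → Σ₂¹. -/
noncomputable def varsigma (α : Seq) : Seq :=
  if α ∈ ParryP then α else cutZero α (nAlpha α)

/-- The map ς' : Σ₂⁰ → Σ₂⁰, ς'(β) = mirror of ς(β̄). -/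
noncomputable def varsigma' (β : Seq) : Seq := mirror (varsigma (mirror β))

/-- M_α(β) = min{m ≥ 1 : σ^m β ≻ α}. -/
noncomputable def Msub (α β : Seq) : ℕ := sInf {m | 1 ≤ m ∧ lexLt α (shift^[m] β)}

/-- N_β(α) = min{n ≥ 1 : σⁿ α ≺ β}. -/
noncomputable def Nsub (α β : Seq) : ℕ := sInf {n | 1 ≤ n ∧ lexLt (shift^[n] α) β}

/-- ι(α) = (α₁ ⋯ α_{N_β(α)-1} 0)^∞. -/
noncomputable def iotaA (α β : Seq) : Seq := cutZero α (Nsub α β)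

/-- ι(β) = (β₁ ⋯ β_{M_α(β)-1} 1)^∞. -/
noncomputable def iotaB (α β : Seq) : Seq := cutOne β (Msub α β)

/-- ξ_α(β) = (β₁ ⋯ β_{M-1} 1)^∞ with M = M_α(β). -/
noncomputable def xiA (α β : Seq) : Seq := cutOne β (Msub α β)

/-- ξ'_β(α) = (α₁ ⋯ α_{N-1} 0)^∞ with N = N_β(α). -/
noncomputable def xiB (α β : Seq) : Seq := cutZero α (Nsub α β)

/-- A two sided extremal pair. -/
def twoSidedExtremal (α β : Seq) : Prop :=
  (∃ n, 1 ≤ n ∧ lexLt α (shift^[n] β)) ∧ (∃ m, 1 ≤ m ∧ lexLt (shift^[m] α) β)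

/-- A right extremal pair. -/
def rightExtremal (α β : Seq) : Prop :=
  (∀ m, 1 ≤ m → lexLt β (shift^[m] α)) ∧ (∃ n, 1 ≤ n ∧ lexLt α (shift^[n] β))

/-- A left extremal pair. -/
def leftExtremal (α β : Seq) : Prop :=
  (∀ n, 1 ≤ n → lexLt (shift^[n] β) α) ∧ (∃ m, 1 ≤ m ∧ lexLt (shift^[m] α) β)

/-- Dyadic rationals. -/
def IsDyadic (t : ℝ) : Prop := ∃ (z : ℤ) (n : ℕ), t = (z : ℝ) / 2 ^ n

/-- α₁ ⋯ α_n 1^∞. -/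
def onesAfter (α : Seq) (n : ℕ) : Seq := fun i => if i < n then α i else true

end DoublingHole

namespace DoublingHole

theorem iterate_dbl_eq_fract (n : ℕ) (x : ℝ) :
    dbl^[n + 1] x = Int.fract (2 ^ (n + 1) * x) := by
  induction n with
  | zero => simp [dbl]
  | succ n ih =>
    rw [Function.iterate_succ_apply', ih, dbl, Int.fract_eq_fract]
    refine ⟨-(2 * ⌊(2 : ℝ) ^ (n + 1) * x⌋), ?_⟩
    rw [Int.fract]
    push_cast
    ring

theorem continuousAt_iterate_dbl {n : ℕ} {x : ℝ} (h : dbl^[n] x ≠ 0) :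
    ContinuousAt (dbl^[n]) x := by
  cases n with
  | zero => exact continuousAt_id
  | succ n =>
    have heq : dbl^[n + 1] = fun y => Int.fract (2 ^ (n + 1) * y) :=
      funext (iterate_dbl_eq_fract n)
    rw [heq] at h ⊢
    have hf : ContinuousAt (Int.fract : ℝ → ℝ) (2 ^ (n + 1) * x) := by
      refine continuousAt_fract fun hx => h ?_
      rw [Int.fract_eq_iff]
      exact ⟨le_rfl, one_pos, _, by rw [sub_zero]; exact hx⟩
    exact ContinuousAt.comp (f := fun y : ℝ => 2 ^ (n + 1) * y) hf (by fun_prop)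

/-- An orbit entering the open hole persists under perturbing the point and the hole. -/
theorem exists_radius_iterate_mem {a b x : ℝ} (ha : 0 < a) {n : ℕ}
    (h : dbl^[n] x ∈ Set.Ioo a b) :
    ∃ δ > 0, ∀ y c d : ℝ, |y - x| < δ → |c - a| < δ → |d - b| < δ →
      dbl^[n] y ∈ Set.Ioo c d := by
  have hc : ContinuousAt (fun q : ℝ × ℝ × ℝ => dbl^[n] q.1) (x, a, b) :=
    ContinuousAt.comp (f := Prod.fst) (continuousAt_iterate_dbl (ha.trans h.1).ne')
      continuousAt_fst
  have hev : ∀ᶠ q : ℝ × ℝ × ℝ in nhds (x, a, b), dbl^[n] q.1 ∈ Set.Ioo q.2.1 q.2.2 :=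
    (ContinuousAt.eventually_lt (by fun_prop) hc h.1).and
      (hc.eventually_lt (by fun_prop) h.2)
  obtain ⟨δ, hδ, H⟩ := Metric.eventually_nhds_iff.1 hev
  refine ⟨δ, hδ, fun y c d hy hca hd => @H (y, c, d) ?_⟩
  simp only [Prod.dist_eq, Real.dist_eq]
  exact max_lt hy (max_lt hca hd)

/-- If every point of the second hole is eventually mapped into the first one, then avoiding the
first hole implies avoiding the second. -/
theorem Xset_subset_Xset {a b c d : ℝ}
    (h : ∀ y ∈ Set.Ioo c d, ∃ n, dbl^[n] y ∈ Set.Ioo a b) : Xset a b ⊆ Xset c d := by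
  rintro x ⟨hx, hX⟩
  refine ⟨hx, fun k hk => ?_⟩
  obtain ⟨n, hn⟩ := h _ hk
  rw [← Function.iterate_add_apply] at hn
  exact hX _ hn

/-- every (a,b) ∈ S has a neighbourhood U ⊆ D₁ (open in D₁) on
which the exceptional set is constant. -/
theorem statement4 (a b : ℝ) (hab : (a, b) ∈ Sset) :
    ∃ U : Set (ℝ × ℝ), U ⊆ D1 ∧ (a, b) ∈ U ∧
      IsOpen {p : ↥D1 | (p : ℝ × ℝ) ∈ U} ∧
      ∀ p ∈ U, Xset p.1 p.2 = Xset a b := by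
  obtain ⟨hD, ⟨n, -, hn⟩, m, -, hm⟩ := hab
  have ha : 0 < a := by linarith [hD.1.1]
  obtain ⟨δ₁, hδ₁, H₁⟩ := exists_radius_iterate_mem ha hn
  obtain ⟨δ₂, hδ₂, H₂⟩ := exists_radius_iterate_mem ha hm
  set δ := min δ₁ δ₂
  have hδ : 0 < δ := lt_min hδ₁ hδ₂
  have key : ∀ c d y : ℝ, |c - a| < δ → |d - b| < δ → |y - a| < δ ∨ |y - b| < δ →
      ∃ k, dbl^[k] y ∈ Set.Ioo c d := by
    rintro c d y hc hd (hy | hy)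
    · exact ⟨n, H₁ y c d (hy.trans_le (min_le_left _ _)) (hc.trans_le (min_le_left _ _))
        (hd.trans_le (min_le_left _ _))⟩
    · exact ⟨m, H₂ y c d (hy.trans_le (min_le_right _ _)) (hc.trans_le (min_le_right _ _))
        (hd.trans_le (min_le_right _ _))⟩
  refine ⟨{p | p ∈ D1 ∧ |p.1 - a| < δ ∧ |p.2 - b| < δ}, fun p hp => hp.1,
    ⟨hD, by simpa using hδ, by simpa using hδ⟩, ?_, ?_⟩
  · have hset : {p : ↥D1 | (p : ℝ × ℝ) ∈ {p : ℝ × ℝ | p ∈ D1 ∧ |p.1 - a| < δ ∧ |p.2 - b| < δ}} =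
        {p : ↥D1 | |p.1.1 - a| < δ} ∩ {p : ↥D1 | |p.1.2 - b| < δ} := by
      ext p
      simp
    rw [hset]
    exact (isOpen_lt (by fun_prop) continuous_const).inter
      (isOpen_lt (by fun_prop) continuous_const)
  · rintro ⟨c, d⟩ ⟨-, hc, hd⟩
    dsimp only at hc hd ⊢
    have hc' := abs_lt.1 hc
    have hd' := abs_lt.1 hd
    refine (Xset_subset_Xset fun y hy => ?_).antisymm (Xset_subset_Xset fun y hy => ?_)
    · by_cases h : y ∈ Set.Ioo c d
      · exact ⟨0, h⟩
      · refine key c d y hc hd ?_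
        rcases le_or_gt y c with hyc | hyc
        · exact Or.inl (abs_lt.2 ⟨by linarith [hy.1], by linarith⟩)
        · have hdy : d ≤ y := not_lt.1 fun hyd => h ⟨hyc, hyd⟩
          exact Or.inr (abs_lt.2 ⟨by linarith, by linarith [hy.2]⟩)
    · by_cases h : y ∈ Set.Ioo a b
      · exact ⟨0, h⟩
      · refine key a b y (by simpa using hδ) (by simpa using hδ) ?_
        rcases le_or_gt y a with hya | hya
        · exact Or.inl (abs_lt.2 ⟨by linarith [hy.1], by linarith⟩)
        · have hby : b ≤ y := not_lt.1 fun hyb => h ⟨hya, hyb⟩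
          exact Or.inr (abs_lt.2 ⟨by linarith, by linarith [hy.2]⟩)

end DoublingHole
end

section
/- There is an open and dense subset of D₁, whose complement in D₁ has two-dimensional Lebesgue measure zero, on which the topological entropy function (a,b) ↦ h_top(f_{(a,b)}) = lim_{n→∞} (1/n) log₂ |B_n(Σ_{(α,β)})| is locally constant, where α, β ∈ Σ₂ satisfy π(α) = 2a and π(β) = 2b−1. -/
open Filter MeasureTheory

namespace DoublingHole

/-- The binary digits of a real number, the first one being the digit of `1/2`. -/
noncomputable def binaryDigits (t : ℝ) : Seq := fun i => decide (⌊2 ^ (i + 1) * t⌋ % 2 = 1)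

theorem floor_two_pow_succ (t : ℝ) (k : ℕ) :
    ⌊2 ^ (k + 1) * t⌋ = 2 * ⌊2 ^ k * t⌋ + if binaryDigits t k then 1 else 0 := by
  have h1 := Int.floor_le (2 ^ k * t)
  have h2 := Int.lt_floor_add_one (2 ^ k * t)
  have h3 : (2 : ℝ) ^ (k + 1) * t = 2 * (2 ^ k * t) := by ring
  have h4 : 2 * ⌊2 ^ k * t⌋ ≤ ⌊2 ^ (k + 1) * t⌋ := by
    rw [Int.le_floor]; push_cast; linarith
  have h5 : ⌊2 ^ (k + 1) * t⌋ < 2 * ⌊2 ^ k * t⌋ + 2 := by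
    rw [Int.floor_lt]; push_cast; linarith
  by_cases h : ⌊2 ^ (k + 1) * t⌋ % 2 = 1
  · simp only [binaryDigits, h, decide_true, if_true]; omega
  · simp only [binaryDigits, h, decide_false]
    simp only [Bool.false_eq_true, if_false]; omega

theorem sum_binaryDigits {t : ℝ} (ht : t ∈ Set.Ico (0 : ℝ) 1) (n : ℕ) :
    ∑ i ∈ Finset.range n, (if binaryDigits t i then (1 : ℝ) / 2 ^ (i + 1) else 0) =
      ⌊2 ^ n * t⌋ / 2 ^ n := by
  induction n with
  | zero =>
    have : ⌊t⌋ = 0 := Int.floor_eq_zero_iff.2 ht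
    simp [this]
  | succ n ih =>
    rw [Finset.sum_range_succ, ih, floor_two_pow_succ]
    split_ifs <;> push_cast <;> field_simp <;> ring

theorem piMap_binaryDigits {t : ℝ} (ht : t ∈ Set.Ico (0 : ℝ) 1) : piMap (binaryDigits t) = t := by
  refine HasSum.tsum_eq ?_
  rw [hasSum_iff_tendsto_nat_of_nonneg (fun i => by split_ifs <;> positivity)]
  simp only [sum_binaryDigits ht]
  have h0 : Tendsto (fun n : ℕ => t - (1 / 2 : ℝ) ^ n) atTop (nhds t) := by
    simpa using tendsto_const_nhds.sub
      (tendsto_pow_atTop_nhds_zero_of_lt_one (r := (1 / 2 : ℝ)) (by norm_num) (by norm_num))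
  refine tendsto_of_tendsto_of_tendsto_of_le_of_le h0 tendsto_const_nhds (fun n => ?_) (fun n => ?_)
  · have h1 := Int.lt_floor_add_one (2 ^ n * t)
    have h2 : (0 : ℝ) < 2 ^ n := by positivity
    simp only [one_div, inv_pow]
    rw [le_div_iff₀ h2, sub_mul, inv_mul_cancel₀ h2.ne']
    linarith
  · have h1 := Int.floor_le (2 ^ n * t)
    have h2 : (0 : ℝ) < 2 ^ n := by positivity
    simp only
    rw [div_le_iff₀ h2]
    linarith

theorem lexLt_binaryDigits {s t : ℝ} (hs : 0 ≤ s) (ht : t < 1) (hst : s < t) :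
    lexLt (binaryDigits s) (binaryDigits t) := by
  have hex : ∃ k : ℕ, ⌊2 ^ k * s⌋ ≠ ⌊2 ^ k * t⌋ := by
    obtain ⟨k, hk⟩ := pow_unbounded_of_one_lt (1 / (t - s)) (one_lt_two (α := ℝ))
    refine ⟨k, fun h => ?_⟩
    have h1 : 1 < 2 ^ k * (t - s) := by
      rwa [div_lt_iff₀ (sub_pos.2 hst)] at hk
    have h2 := Int.floor_le (2 ^ k * s)
    have h3 := Int.lt_floor_add_one (2 ^ k * t)
    rw [← h] at h3
    linarith
  classical
  obtain ⟨m, hm⟩ : ∃ m, Nat.find hex = m + 1 := by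
    refine Nat.exists_eq_succ_of_ne_zero fun h => Nat.find_spec hex ?_
    rw [h]
    simp only [pow_zero, one_mul]
    rw [Int.floor_eq_zero_iff.2 ⟨hs, hst.trans ht⟩, Int.floor_eq_zero_iff.2 ⟨hs.trans hst.le, ht⟩]
  have heq : ∀ k ≤ m, ⌊2 ^ k * s⌋ = ⌊2 ^ k * t⌋ := fun k hk =>
    not_not.1 (Nat.find_min hex (show k < Nat.find hex by omega))
  have hne : ⌊2 ^ (m + 1) * s⌋ ≠ ⌊2 ^ (m + 1) * t⌋ := hm ▸ Nat.find_spec hex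
  refine ⟨m, fun i hi => ?_, ?_⟩
  · simp only [binaryDigits, heq (i + 1) (by omega)]
  · have hle : ⌊2 ^ (m + 1) * s⌋ ≤ ⌊2 ^ (m + 1) * t⌋ :=
      Int.floor_le_floor (by gcongr)
    have h1 := floor_two_pow_succ s m
    have h2 := floor_two_pow_succ t m
    rw [heq m le_rfl] at h1
    cases hsm : binaryDigits s m <;> cases htm : binaryDigits t m <;> simp [hsm, htm] at h1 h2 ⊢ <;>
      omega

theorem shift_iterate_apply (n : ℕ) (x : Seq) (i : ℕ) : (shift^[n] x) i = x (i + n) := by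
  induction n generalizing x with
  | zero => rfl
  | succ n ih =>
    rw [Function.iterate_succ_apply, ih]
    simp only [shift]
    congr 1

theorem shift_iterate_binaryDigits (t : ℝ) (n : ℕ) (z : ℤ) :
    shift^[n] (binaryDigits t) = binaryDigits (2 ^ n * t - z) := by
  funext i
  have h : (2 : ℝ) ^ (i + 1) * (2 ^ n * t - z) =
      2 ^ (i + n + 1) * t - ((2 * (2 ^ i * z) : ℤ) : ℝ) := by
    push_cast; ring
  simp only [shift_iterate_apply, binaryDigits, h, Int.floor_sub_intCast]
  congr 1
  rw [Int.sub_mul_emod_self_left]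

/-- Doubling a point of `(a, b)` gives a point above `2 * a` or below `2 * b - 1`. -/
theorem shift_binaryDigits_escapes {a b t : ℝ} (ha : 1 / 4 < a) (hb : b < 3 / 4) {n : ℕ} {z : ℤ}
    (h : 2 ^ n * t - z ∈ Set.Ioo a b) (w : ℤ) :
    ∃ m, lexLt (binaryDigits (2 * a)) (shift^[m] (binaryDigits (2 * t - w))) ∨
      lexLt (shift^[m] (binaryDigits (2 * t - w))) (binaryDigits (2 * b - 1)) := by
  obtain ⟨h1, h2⟩ := h
  have hshift : ∀ c : ℤ, (2 : ℝ) ^ n * (2 * t - w) - ((2 * z - 2 ^ n * w + c : ℤ) : ℝ) =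
      2 * (2 ^ n * t - z) - c := fun c => by push_cast; ring
  refine ⟨n, ?_⟩
  rcases lt_or_ge (2 ^ n * t - z) (1 / 2) with h3 | h3
  · left
    rw [shift_iterate_binaryDigits _ n (2 * z - 2 ^ n * w + 0), hshift]
    apply lexLt_binaryDigits <;> push_cast <;> linarith
  · right
    rw [shift_iterate_binaryDigits _ n (2 * z - 2 ^ n * w + 1), hshift]
    apply lexLt_binaryDigits <;> push_cast <;> linarith

theorem lexLt_of_not_lexLe {x y : Seq} (h : ¬ lexLe x y) : lexLt y x := by
  classical
  have hne : x ≠ y := fun e => h (Or.inr e)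
  have hex : ∃ k, x k ≠ y k := Function.ne_iff.1 hne
  have hmin : ∀ i < Nat.find hex, x i = y i := fun i hi => not_not.1 (Nat.find_min hex hi)
  rcases lt_or_gt_of_ne (Nat.find_spec hex) with hlt | hgt
  · exact absurd (Or.inl ⟨_, hmin, hlt⟩) h
  · exact ⟨_, fun i hi => (hmin i hi).symm, hgt⟩

theorem lexLt_irrefl (x : Seq) : ¬ lexLt x x := fun ⟨_, _, h⟩ => lt_irrefl _ h

theorem not_lexLe_of_lexLt {x y : Seq} (h : lexLt x y) : ¬ lexLe y x := by
  rintro (h' | rfl)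
  · obtain ⟨j, hj, hj'⟩ := h
    obtain ⟨k, hk, hk'⟩ := h'
    rcases lt_trichotomy j k with hjk | rfl | hjk
    · exact hj'.ne (hk j hjk).symm
    · exact lt_asymm hj' hk'
    · exact hk'.ne (hj k hjk).symm
  · exact lexLt_irrefl _ h

/-- Two sequences share their first `L` symbols. -/
def AgreeUpTo (L : ℕ) (x y : Seq) : Prop := ∀ i < L, x i = y i

theorem AgreeUpTo.symm {L : ℕ} {x y : Seq} (h : AgreeUpTo L x y) : AgreeUpTo L y x :=
  fun i hi => (h i hi).symm

theorem AgreeUpTo.trans {L : ℕ} {x y z : Seq} (h : AgreeUpTo L x y) (h' : AgreeUpTo L y z) :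
    AgreeUpTo L x z := fun i hi => (h i hi).trans (h' i hi)

theorem AgreeUpTo.mono {K L : ℕ} {x y : Seq} (h : AgreeUpTo L x y) (hKL : K ≤ L) :
    AgreeUpTo K x y := fun i hi => h i (hi.trans_le hKL)

theorem AgreeUpTo.shift_iterate {L n : ℕ} {x y : Seq} (h : AgreeUpTo (L + n) x y) :
    AgreeUpTo L (shift^[n] x) (shift^[n] y) := fun i hi => by
  rw [shift_iterate_apply, shift_iterate_apply]
  exact h _ (by omega)

theorem lexLt.exists_agreeUpTo {x y : Seq} (h : lexLt x y) :
    ∃ L, ∀ x' y', AgreeUpTo L x' x → AgreeUpTo L y' y → lexLt x' y' := by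
  obtain ⟨k, hk, hk'⟩ := h
  refine ⟨k + 1, fun x' y' hx hy => ⟨k, fun i hi => ?_, ?_⟩⟩
  · rw [hx i (by omega), hy i (by omega), hk i hi]
  · rwa [hx k (by omega), hy k (by omega)]

theorem agreeUpTo_of_between {L : ℕ} {x y z : Seq} (hxy : lexLe x y) (hyz : lexLe y z)
    (hxz : AgreeUpTo L x z) : AgreeUpTo L x y := by
  rcases hxy with ⟨j, hj, hj'⟩ | rfl
  · rcases hyz with ⟨k, hk, hk'⟩ | rfl
    · intro i hi
      rcases lt_or_ge i j with hij | hij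
      · exact hj i hij
      · have hjL := hxz j (by omega)
        rcases lt_trichotomy j k with h | rfl | h
        · exact absurd ((hk j h).trans hjL.symm) hj'.ne'
        · exact absurd (hj'.trans hk') (hjL ▸ lt_irrefl _)
        · rw [← hj k h, hxz k (by omega)] at hk'
          exact absurd hk' (lt_irrefl _)
    · exact hxz
  · exact fun _ _ => rfl

/-- A sequence violating the constraints `(α, β)` has a prefix that is forbidden in `(α', β')` for
all `α'`, `β'` close to `α`, `β`. -/
theorem exists_forall_notMem_lexSubshift {α β y : Seq}
    (h : ∃ m, lexLt α (shift^[m] y) ∨ lexLt (shift^[m] y) β) :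
    ∃ L, ∀ x α' β', AgreeUpTo L x y → AgreeUpTo L α' α → AgreeUpTo L β' β →
      x ∉ lexSubshift α' β' := by
  obtain ⟨m, h | h⟩ := h
  · obtain ⟨L, hL⟩ := h.exists_agreeUpTo
    exact ⟨L + m, fun x α' β' hx hα _ hmem => not_lexLe_of_lexLt
      (hL _ _ (hα.mono (by omega)) hx.shift_iterate) (hmem m).2⟩
  · obtain ⟨L, hL⟩ := h.exists_agreeUpTo
    exact ⟨L + m, fun x α' β' hx _ hβ hmem => not_lexLe_of_lexLt
      (hL _ _ hx.shift_iterate (hβ.mono (by omega))) (hmem m).1⟩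

theorem shift_iterate_mem_lexSubshift {α β x : Seq} (h : x ∈ lexSubshift α β) (n : ℕ) :
    shift^[n] x ∈ lexSubshift α β := fun m => by
  rw [← Function.iterate_add_apply]
  exact h _

theorem exists_lexSubshift_eq {α β : Seq}
    (hα : ∃ m, lexLt α (shift^[m] α) ∨ lexLt (shift^[m] α) β)
    (hβ : ∃ m, lexLt α (shift^[m] β) ∨ lexLt (shift^[m] β) β) :
    ∃ L, ∀ α' β', AgreeUpTo L α' α → AgreeUpTo L β' β →
      lexSubshift α' β' = lexSubshift α β := by
  obtain ⟨L₁, h₁⟩ := exists_forall_notMem_lexSubshift hα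
  obtain ⟨L₂, h₂⟩ := exists_forall_notMem_lexSubshift hβ
  let L := max L₁ L₂
  have key : ∀ α₁ β₁ α₂ β₂, AgreeUpTo L α₁ α → AgreeUpTo L β₁ β → AgreeUpTo L α₂ α →
      AgreeUpTo L β₂ β → lexSubshift α₁ β₁ ⊆ lexSubshift α₂ β₂ := by
    intro α₁ β₁ α₂ β₂ ha₁ hb₁ ha₂ hb₂ x hx n
    have hxn := shift_iterate_mem_lexSubshift hx n
    constructor <;> by_contra hcon
    · have hag := (agreeUpTo_of_between (hx n).1 (Or.inl (lexLt_of_not_lexLe hcon))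
        (hb₁.trans hb₂.symm)).symm
      exact h₂ _ _ _ ((hag.trans hb₁).mono (le_max_right _ _)) (ha₁.mono (le_max_right _ _))
        (hb₁.mono (le_max_right _ _)) hxn
    · have hag := (agreeUpTo_of_between (Or.inl (lexLt_of_not_lexLe hcon)) (hx n).2
        (ha₂.trans ha₁.symm)).symm
      exact h₁ _ _ _ ((hag.trans ha₂).mono (le_max_left _ _)) (ha₁.mono (le_max_left _ _))
        (hb₁.mono (le_max_left _ _)) hxn
  have hrefl : ∀ y : Seq, AgreeUpTo L y y := fun _ _ _ => rfl
  exact ⟨L, fun α' β' ha hb => (key _ _ _ _ ha hb (hrefl _) (hrefl _)).antisymm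
    (key _ _ _ _ (hrefl _) (hrefl _) ha hb)⟩

/-- No iterate of `t` under doubling is an integer. -/
def NonDyadic (t : ℝ) : Prop := ∀ (k : ℕ) (z : ℤ), 2 ^ k * t ≠ z

theorem NonDyadic.two_mul_sub {t : ℝ} (h : NonDyadic t) (z : ℤ) : NonDyadic (2 * t - z) :=
  fun k w hw => h (k + 1) (w + 2 ^ k * z) (by push_cast; rw [← hw]; ring)

theorem NonDyadic.eventually_agreeUpTo {t : ℝ} (h : NonDyadic t) (L : ℕ) :
    ∀ᶠ s in nhds t, AgreeUpTo L (binaryDigits s) (binaryDigits t) := by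
  have hdigit : ∀ i : ℕ, ∀ᶠ s in nhds t, binaryDigits s i = binaryDigits t i := by
    intro i
    have hcont : Tendsto (fun s : ℝ => 2 ^ (i + 1) * s) (nhds t) (nhds (2 ^ (i + 1) * t)) :=
      (continuous_const.mul continuous_id).tendsto t
    have hlt : (⌊2 ^ (i + 1) * t⌋ : ℝ) < 2 ^ (i + 1) * t :=
      lt_of_le_of_ne (Int.floor_le _) (h (i + 1) _).symm
    filter_upwards [hcont (Ioo_mem_nhds hlt (Int.lt_floor_add_one _))] with s hs
    have : ⌊2 ^ (i + 1) * s⌋ = ⌊2 ^ (i + 1) * t⌋ := Int.floor_eq_iff.2 ⟨hs.1.le, hs.2⟩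
    simp only [binaryDigits, this]
  exact (Set.finite_lt_nat L).eventually_all.2 fun i _ => hdigit i

theorem ae_nonDyadic : ∀ᵐ t : ℝ, NonDyadic t := by
  refine measure_mono_null (t := (⋃ (k : ℕ) (z : ℤ), {(z : ℝ) / 2 ^ k} : Set ℝ)) (fun t ht => ?_)
    (Set.Countable.measure_zero (Set.countable_iUnion fun k => Set.countable_iUnion fun z =>
      Set.countable_singleton _) volume)
  simp only [Set.mem_compl_iff, Set.mem_ofPred_eq, NonDyadic, not_forall, not_not] at ht
  obtain ⟨k, z, h⟩ := ht
  simp only [Set.mem_iUnion, Set.mem_singleton_iff]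
  exact ⟨k, z, by rw [← h]; field_simp⟩

theorem ae_exists_iterate_mem_of_ergodic {X : Type*} [MeasurableSpace X] [TopologicalSpace X]
    [OpensMeasurableSpace X] {μ : Measure X} [IsFiniteMeasure μ] [μ.IsOpenPosMeasure] {f : X → X}
    (hf : Ergodic f μ) {U : Set X} (hU : IsOpen U) (hne : U.Nonempty) :
    ∀ᵐ x ∂μ, ∃ n : ℕ, f^[n] x ∈ U := by
  let E : Set X := ⋃ n : ℕ, f^[n] ⁻¹' U
  have hE : MeasurableSet E :=
    MeasurableSet.iUnion fun n => (hf.measurable.iterate n) hU.measurableSet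
  have hsub : f ⁻¹' E ⊆ E := by
    rintro x hx
    simp only [E, Set.mem_preimage, Set.mem_iUnion] at hx ⊢
    obtain ⟨n, hn⟩ := hx
    exact ⟨n + 1, by rwa [Function.iterate_succ_apply]⟩
  have hUE : U ⊆ E := fun x hx => Set.mem_iUnion.2 ⟨0, hx⟩
  rcases hf.ae_empty_or_univ_of_preimage_ae_le hE.nullMeasurableSet hsub.eventuallyLE with h | h
  · exact absurd (measure_mono_null hUE (ae_eq_empty.1 h)) (hU.measure_pos μ hne).ne'
  · filter_upwards [eventuallyEq_univ.1 h] with x hx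
    simpa [E] using hx

/-- Almost every orbit of the doubling map visits every rational interval. -/
theorem ae_forall_exists_two_pow_mem_Ioo :
    ∀ᵐ t : ℝ ∂(volume.restrict (Set.Ioc 0 1)), ∀ r s : ℚ, r < s →
      ∃ (n : ℕ) (z : ℤ), 2 ^ n * t - z ∈ Set.Ioo (r : ℝ) s := by
  rw [ae_all_iff]; intro r
  rw [ae_all_iff]; intro s
  rw [eventually_imp_distrib_left]; intro hrs
  have hmk := AddCircle.measurePreserving_mk 1 0
  rw [zero_add] at hmk
  have hopen : IsOpen (((↑) : ℝ → AddCircle (1 : ℝ)) '' Set.Ioo (r : ℝ) s) :=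
    QuotientAddGroup.isOpenMap_coe _ isOpen_Ioo
  have hne : (((↑) : ℝ → AddCircle (1 : ℝ)) '' Set.Ioo (r : ℝ) s).Nonempty :=
    (Set.nonempty_Ioo.2 (by exact_mod_cast hrs)).image _
  have hae := ae_exists_iterate_mem_of_ergodic (AddCircle.ergodic_nsmul (T := (1 : ℝ)) one_lt_two)
    hopen hne
  filter_upwards [hmk.quasiMeasurePreserving.ae hae] with t ht
  obtain ⟨n, u, hu, hun⟩ := ht
  rw [smul_iterate_apply, ← AddCircle.coe_nsmul, eq_comm, QuotientAddGroup.eq,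
    AddSubgroup.mem_zmultiples_iff] at hun
  obtain ⟨z, hz⟩ := hun
  refine ⟨n, -z, ?_⟩
  simp only [zsmul_eq_mul, mul_one, nsmul_eq_mul, Nat.cast_pow, Nat.cast_ofNat] at hz
  convert hu using 1
  push_cast
  linarith

theorem finite_wordsOfLen (A : Set Seq) (n : ℕ) : (wordsOfLen A n).Finite :=
  (List.finite_length_eq Bool n).subset fun _ h => h.1

theorem ncard_wordsOfLen_add_le (A : Set Seq) (m n : ℕ) :
    (wordsOfLen A (m + n)).ncard ≤ (wordsOfLen A m).ncard * (wordsOfLen A n).ncard := by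
  rw [← Set.ncard_prod]
  refine Set.ncard_le_ncard_of_injOn (fun w => (w.take m, w.drop m)) ?_ ?_
    ((finite_wordsOfLen A m).prod (finite_wordsOfLen A n))
  · rintro w ⟨hlen, x, hx, i, hw⟩
    have hget : ∀ (j : ℕ) (hj : j < w.length), w[j] = x (i + j) := by
      intro j hj
      have := congrArg (fun l : List Bool => l[j]?) hw
      simpa [hj] using this
    refine ⟨⟨by simp [hlen], x, hx, i, ?_⟩, ⟨by simp [hlen], x, hx, i + m, ?_⟩⟩
    · refine List.ext_getElem (by simp) fun j h1 h2 => ?_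
      simp [hget]
    · refine List.ext_getElem (by simp) fun j h1 h2 => ?_
      simp [hget, add_assoc]
  · intro u _ v _ h
    simp only [Prod.mk.injEq] at h
    rw [← List.take_append_drop m u, ← List.take_append_drop m v, h.1, h.2]

theorem subadditive_logb_ncard_wordsOfLen (A : Set Seq) :
    Subadditive fun n => Real.logb 2 (wordsOfLen A n).ncard := by
  intro m n
  have hnonneg : ∀ k, 0 ≤ Real.logb 2 ((wordsOfLen A k).ncard : ℝ) := fun k =>
    div_nonneg (Real.log_natCast_nonneg _) (Real.log_nonneg one_le_two)
  have hle := ncard_wordsOfLen_add_le A m n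
  rcases Nat.eq_zero_or_pos (wordsOfLen A (m + n)).ncard with h | h
  · simp only [h, Nat.cast_zero, Real.logb_zero]
    exact add_nonneg (hnonneg m) (hnonneg n)
  · have hprod := h.trans_le hle
    have hm : (wordsOfLen A m).ncard ≠ 0 := fun h0 => by simp [h0] at hprod
    have hn : (wordsOfLen A n).ncard ≠ 0 := fun h0 => by simp [h0] at hprod
    rw [← Real.logb_mul (by exact_mod_cast hm) (by exact_mod_cast hn)]
    exact Real.logb_le_logb_of_le one_lt_two (by exact_mod_cast h) (by exact_mod_cast hle)

theorem exists_tendsto_entropy (A : Set Seq) :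
    ∃ h : ℝ, Tendsto (fun n : ℕ => Real.logb 2 (wordsOfLen A n).ncard / (n : ℝ)) atTop (nhds h) :=
  ⟨_, (subadditive_logb_ncard_wordsOfLen A).tendsto_lim ⟨0, by
    rintro _ ⟨n, rfl⟩
    exact div_nonneg (div_nonneg (Real.log_natCast_nonneg _) (Real.log_nonneg one_le_two))
      n.cast_nonneg⟩⟩

theorem Xset_subset_Xset_s5 {a a' b : ℝ} (h : a ≤ a') : Xset a b ⊆ Xset a' b :=
  fun _ hx => ⟨hx.1, fun n hn => hx.2 n ⟨h.trans_lt hn.1, hn.2⟩⟩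

theorem mem_D1_of_le {p q : ℝ × ℝ} (hp : p ∈ D1) (h1 : p.1 ≤ q.1) (h1' : q.1 < 1 / 2)
    (h2 : q.2 ≤ p.2) (h2' : 1 / 2 < q.2) : q ∈ D1 := by
  obtain ⟨⟨ha, ha'⟩, ⟨hb, hb'⟩, hχ⟩ := hp
  refine ⟨⟨ha.trans_le h1, h1'⟩, ⟨h2', h2.trans_lt hb'⟩, h2.trans (hχ.trans ?_)⟩
  refine csSup_le_csSup ⟨1, fun b hb => hb.1.2.le⟩ ?_
    fun b hb => ⟨hb.1, fun hc => hb.2 (hc.mono (Xset_subset_Xset_s5 h1))⟩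
  by_contra hempty
  rw [chiFn, Set.not_nonempty_iff_eq_empty.1 hempty, Real.sSup_empty] at hχ
  linarith

/-- Every neighbourhood in `D1` of a point of `D1` contains a nonempty open box. -/
theorem volume_D1_inter_ball_pos {p : ℝ × ℝ} (hp : p ∈ D1) {ε : ℝ} (hε : 0 < ε) :
    0 < volume (D1 ∩ Metric.ball p ε) := by
  have h1 : p.1 < 1 / 2 := hp.1.2
  have h2 : 1 / 2 < p.2 := hp.2.1.1
  let U : Set (ℝ × ℝ) :=
    Set.Ioo p.1 (min (1 / 2) (p.1 + ε)) ×ˢ Set.Ioo (max (1 / 2) (p.2 - ε)) p.2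
  have hU : IsOpen U := isOpen_Ioo.prod isOpen_Ioo
  have hne : U.Nonempty := (Set.nonempty_Ioo.2 (lt_min h1 (by linarith))).prod
    (Set.nonempty_Ioo.2 (max_lt h2 (by linarith)))
  refine (hU.measure_pos volume hne).trans_le (measure_mono ?_)
  rintro q ⟨⟨ha, ha'⟩, ⟨hb, hb'⟩⟩
  rw [lt_min_iff] at ha'
  rw [max_lt_iff] at hb
  refine ⟨mem_D1_of_le hp ha.le ha'.1 hb'.le hb.1, ?_⟩
  rw [Metric.mem_ball, Prod.dist_eq, max_lt_iff, Real.dist_eq, Real.dist_eq, abs_lt, abs_lt]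
  refine ⟨⟨?_, ?_⟩, ?_, ?_⟩ <;> linarith

/-- The subshift of the parameter `p`. -/
noncomputable def paramShift (p : ℝ × ℝ) : Set Seq :=
  lexSubshift (binaryDigits (2 * p.1)) (binaryDigits (2 * p.2 - 1))

theorem exists_ball_paramShift_eq {p : ℝ × ℝ} (hp : p ∈ D1)
    (hd₁ : NonDyadic p.1) (hd₂ : NonDyadic p.2)
    (ho₁ : ∀ r s : ℚ, r < s → ∃ (n : ℕ) (z : ℤ), 2 ^ n * p.1 - z ∈ Set.Ioo (r : ℝ) s)
    (ho₂ : ∀ r s : ℚ, r < s → ∃ (n : ℕ) (z : ℤ), 2 ^ n * p.2 - z ∈ Set.Ioo (r : ℝ) s) :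
    ∃ ε > 0, ∀ q, dist q p < ε → paramShift q = paramShift p := by
  obtain ⟨⟨ha, ha'⟩, ⟨hb, hb'⟩, -⟩ := hp
  obtain ⟨r, hr, hr'⟩ := exists_rat_btwn (ha'.trans hb)
  obtain ⟨s, hs, hs'⟩ := exists_rat_btwn hr'
  have hesc : ∀ (t : ℝ) (w : ℤ),
      (∀ r s : ℚ, r < s → ∃ (n : ℕ) (z : ℤ), 2 ^ n * t - z ∈ Set.Ioo (r : ℝ) s) →
      ∃ m, lexLt (binaryDigits (2 * p.1)) (shift^[m] (binaryDigits (2 * t - w))) ∨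
        lexLt (shift^[m] (binaryDigits (2 * t - w))) (binaryDigits (2 * p.2 - 1)) := by
    intro t w ht
    obtain ⟨n, z, hz⟩ := ht r s (by exact_mod_cast hs)
    exact shift_binaryDigits_escapes ha hb' (Set.Ioo_subset_Ioo hr.le hs'.le hz) w
  have hα := hesc p.1 0 ho₁
  have hβ := hesc p.2 1 ho₂
  have hα' := hd₁.two_mul_sub 0
  have hβ' := hd₂.two_mul_sub 1
  simp only [Int.cast_zero, Int.cast_one, sub_zero] at hα hβ hα' hβ'
  obtain ⟨L, hL⟩ := exists_lexSubshift_eq hα hβ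
  have h₁ : Tendsto (fun q : ℝ × ℝ => 2 * q.1) (nhds p) (nhds (2 * p.1)) :=
    (continuous_const.mul continuous_fst).tendsto p
  have h₂ : Tendsto (fun q : ℝ × ℝ => 2 * q.2 - 1) (nhds p) (nhds (2 * p.2 - 1)) :=
    ((continuous_const.mul continuous_snd).sub continuous_const).tendsto p
  obtain ⟨ε, hε, hball⟩ := Metric.eventually_nhds_iff.1
    ((h₁.eventually (hα'.eventually_agreeUpTo L)).and (h₂.eventually (hβ'.eventually_agreeUpTo L)))
  exact ⟨ε, hε, fun q hq => hL _ _ (hball hq).1 (hball hq).2⟩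

theorem ae_exists_ball_paramShift_eq :
    ∀ᵐ p : ℝ × ℝ, p ∈ D1 → ∃ ε > 0, ∀ q, dist q p < ε → paramShift q = paramShift p := by
  have horbit := ae_forall_exists_two_pow_mem_Ioo
  rw [ae_restrict_iff' measurableSet_Ioc] at horbit
  have h := ae_nonDyadic.and horbit
  filter_upwards [Measure.quasiMeasurePreserving_fst.ae h, Measure.quasiMeasurePreserving_snd.ae h]
    with p h₁ h₂ hp
  obtain ⟨⟨ha, ha'⟩, ⟨hb, hb'⟩, -⟩ := id hp
  exact exists_ball_paramShift_eq hp h₁.1 h₂.1 (h₁.2 ⟨by linarith, by linarith⟩)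
    (h₂.2 ⟨by linarith, by linarith⟩)

/-- there is an open dense subset T of D₁, whose complement in D₁
has two-dimensional Lebesgue measure zero, on which the topological entropy
function (a,b) ↦ lim (1/n) log₂ |Bₙ(Σ_{(α,β)})| (π(α) = 2a, π(β) = 2b−1) is
locally constant. -/
theorem statement5 :
    ∃ (T : Set (ℝ × ℝ)) (H : ℝ × ℝ → ℝ),
      T ⊆ D1 ∧
      IsOpen {p : ↥D1 | (p : ℝ × ℝ) ∈ T} ∧
      Dense {p : ↥D1 | (p : ℝ × ℝ) ∈ T} ∧
      volume (D1 \ T) = 0 ∧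
      (∀ p ∈ D1, ∃ α β : Seq, piMap α = 2 * p.1 ∧ piMap β = 2 * p.2 - 1 ∧
        Tendsto
          (fun n : ℕ =>
            Real.logb 2 ((wordsOfLen (lexSubshift α β) n).ncard) / (n : ℝ))
          atTop (nhds (H p))) ∧
      ∀ p ∈ T, ∃ ε > (0 : ℝ), ∀ q ∈ T, dist q p < ε → H q = H p := by
  choose h hh using exists_tendsto_entropy
  let H : ℝ × ℝ → ℝ := fun p => h (paramShift p)
  let T : Set (ℝ × ℝ) := {p | p ∈ D1 ∧ ∃ ε > 0, ∀ q ∈ D1, dist q p < ε → H q = H p}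
  have hnull : volume (D1 \ T) = 0 := by
    refine measure_mono_null (fun p hp => ?_) ae_exists_ball_paramShift_eq
    intro hgood
    obtain ⟨ε, hε, hq⟩ := hgood hp.1
    exact hp.2 ⟨hp.1, ε, hε, fun q _ hqp => congrArg h (hq q hqp)⟩
  refine ⟨T, H, fun p hp => hp.1, ?_, ?_, hnull, ?_, ?_⟩
  · rw [Metric.isOpen_iff]
    rintro ⟨p, hp⟩ ⟨-, ε, hε, hT⟩
    refine ⟨ε / 2, half_pos hε, fun q hq => ?_⟩
    have hqp : dist (q : ℝ × ℝ) p < ε / 2 := hq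
    refine ⟨q.2, ε / 2, half_pos hε, fun r hr hrq => ?_⟩
    rw [hT q q.2 (by linarith), hT r hr (by linarith [dist_triangle r (q : ℝ × ℝ) p])]
  · rw [Metric.dense_iff]
    rintro ⟨p, hp⟩ ε hε
    by_contra hempty
    have hsub : D1 ∩ Metric.ball p ε ⊆ D1 \ T :=
      fun q hq => ⟨hq.1, fun hqT => hempty ⟨⟨q, hq.1⟩, hq.2, hqT⟩⟩
    exact (volume_D1_inter_ball_pos hp hε).ne' (measure_mono_null hsub hnull)
  · rintro p ⟨⟨ha, ha'⟩, ⟨hb, hb'⟩, -⟩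
    exact ⟨_, _, piMap_binaryDigits ⟨by linarith, by linarith⟩,
      piMap_binaryDigits ⟨by linarith, by linarith⟩, hh _⟩
  · rintro p ⟨-, ε, hε, hT⟩
    exact ⟨ε, hε, fun q hq hqp => hT q hq.1 hqp⟩

end DoublingHole
end
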